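/- For every λ ∈ [0,∞)^V one has ∫_{ℝ^V} exp(−Σ_{i∈V} λ_i β_i) dν_V^{W,θ,η}(β) = exp(−(1/2)⟨√(θ²+λ), W √(θ²+λ)⟩ + (1/2)⟨θ, W θ⟩ + ⟨η, θ − √(θ²+λ)⟩) · ∏_{i∈V} θ_i/√(θ_i² + λ_i), where √(θ²+λ) denotes the vector with entries √(θ_i² + λ_i). -/

import Mathlib

open MeasureTheory Matrix

variable {V : Type*}

/-- `H_β = 2 diag(β) − W`. -/
noncomputable def Hmat [Fintype V] [DecidableEq V] (W : Matrix V V ℝ) (β : V → ℝ) :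
    Matrix V V ℝ :=
  Matrix.diagonal (fun i => 2 * β i) - W

/-- Density of the measure `ν_V^{W,θ,η}` with respect to Lebesgue measure on `ℝ^V`. -/
noncomputable def nuDensity [Fintype V] [DecidableEq V] (W : Matrix V V ℝ) (θ η : V → ℝ)
    (β : V → ℝ) : ℝ :=
  Set.indicator {β : V → ℝ | (Hmat W β).PosDef}
    (fun β =>
      (2 / Real.pi) ^ ((Fintype.card V : ℝ) / 2) *
        Real.exp (-(1 / 2) * (θ ⬝ᵥ Hmat W β *ᵥ θ)
          - (1 / 2) * (η ⬝ᵥ (Hmat W β)⁻¹ *ᵥ η) + η ⬝ᵥ θ) *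
        (∏ i, θ i) / Real.sqrt (Hmat W β).det) β

/-- The measure `ν_V^{W,θ,η}` on `ℝ^V`. -/
noncomputable def nu [Fintype V] [DecidableEq V] (W : Matrix V V ℝ) (θ η : V → ℝ) :
    Measure (V → ℝ) :=
  volume.withDensity (fun β => ENNReal.ofReal (nuDensity W θ η β))


section blk
set_option linter.unusedSectionVars false
variable {U : Type*} [Fintype U] [DecidableEq U]

def blkM (a : ℝ) (w : U → ℝ) (D : Matrix U U ℝ) : Matrix (PUnit ⊕ U) (PUnit ⊕ U) ℝ :=
  fromBlocks (of fun _ _ => a) (of fun _ j => - w j) (of fun i _ => - w i) D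

lemma blk_det (a : ℝ) (w : U → ℝ) (D : Matrix U U ℝ) (hD : D.PosDef) :
    (blkM a w D).det = D.det * (a - w ⬝ᵥ D⁻¹ *ᵥ w) := by
  let _ := hD.isUnit.invertible
  rw [blkM, det_fromBlocks₂₂]
  congr 1
  rw [det_unique]
  simp only [invOf_eq_nonsing_inv, Matrix.sub_apply, of_apply, mul_apply, dotProduct, mulVec]
  congr 1
  simp only [Finset.mul_sum, Finset.sum_mul]
  rw [Finset.sum_comm]
  refine Finset.sum_congr rfl fun i _ => Finset.sum_congr rfl fun j _ => ?_
  ring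

lemma blk_posDef (a : ℝ) (w : U → ℝ) (D : Matrix U U ℝ) (hD : D.PosDef) :
    (blkM a w D).PosDef ↔ 0 < a - w ⬝ᵥ D⁻¹ *ᵥ w := by
  let _ := hD.isUnit.invertible
  constructor
  · intro h
    have := h.det_pos
    rw [blk_det a w D hD] at this
    exact pos_of_mul_pos_right this hD.det_pos.le
  · intro h
    have hs : (blkM a w D).PosSemidef := by
      have e : blkM a w D = fromBlocks (of fun _ _ => a) (of fun _ j => - w j)
        (of fun (_ : PUnit) j => - w j)ᴴ D := by
        unfold blkM; congr 1
      rw [e, PosDef.fromBlocks₂₂ _ _ hD]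
      have e2 : ((of fun _ _ => a) - (of fun (_ : PUnit) j => - w j) * D⁻¹ *
        (of fun (_ : PUnit) j => - w j)ᴴ : Matrix PUnit PUnit ℝ) =
          diagonal fun _ => (a - w ⬝ᵥ D⁻¹ *ᵥ w) := by
        ext i j
        obtain rfl : i = j := Subsingleton.elim _ _
        rw [diagonal_apply_eq]
        simp only [Matrix.sub_apply, of_apply, mul_apply, dotProduct, mulVec, conjTranspose_apply, star_trivial]
        congr 1
        simp only [Finset.mul_sum, Finset.sum_mul]
        rw [Finset.sum_comm]
        refine Finset.sum_congr rfl fun i _ => Finset.sum_congr rfl fun j _ => ?_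
        ring
      rw [e2]
      exact PosSemidef.diagonal fun _ => h.le
    rw [hs.posDef_iff_det_ne_zero, blk_det a w D hD]
    exact (mul_pos hD.det_pos h).ne'

lemma blk_mulVec (a : ℝ) (w : U → ℝ) (D : Matrix U U ℝ) (x : ℝ) (y : U → ℝ) :
    blkM a w D *ᵥ Sum.elim (fun _ => x) y =
      Sum.elim (fun _ => a * x - w ⬝ᵥ y) (D *ᵥ y - x • w) := by
  rw [blkM, fromBlocks_mulVec]
  ext i
  rcases i with i | i
  · simp [mulVec, dotProduct, sub_eq_add_neg]
  · simp [mulVec, dotProduct]; ring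

lemma blk_dot (x x' : ℝ) (y y' : U → ℝ) :
    (Sum.elim (fun _ => x) y : PUnit ⊕ U → ℝ) ⬝ᵥ Sum.elim (fun _ => x') y' = x * x' + y ⬝ᵥ y' := by
  simp [dotProduct]

lemma blk_quad (a : ℝ) (w : U → ℝ) (D : Matrix U U ℝ) (x : ℝ) (y : U → ℝ) :
    (Sum.elim (fun _ => x) y) ⬝ᵥ blkM a w D *ᵥ Sum.elim (fun _ => x) y =
      x ^ 2 * a - 2 * x * (w ⬝ᵥ y) + y ⬝ᵥ D *ᵥ y := by
  rw [blk_mulVec, blk_dot, dotProduct_sub, dotProduct_smul, smul_eq_mul, dotProduct_comm y w]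
  ring

lemma symm_inv_dot (D : Matrix U U ℝ) (hD : D.PosDef) (x y : U → ℝ) :
    x ⬝ᵥ D⁻¹ *ᵥ y = y ⬝ᵥ D⁻¹ *ᵥ x := by
  have h : (D⁻¹)ᵀ = D⁻¹ := by
    have := hD.inv.isHermitian
    simpa [IsHermitian] using this
  rw [dotProduct_comm, ← vecMul_transpose, h, ← dotProduct_mulVec]

lemma blk_inv_quad (a : ℝ) (w : U → ℝ) (D : Matrix U U ℝ) (hD : D.PosDef)
    (hs : 0 < a - w ⬝ᵥ D⁻¹ *ᵥ w) (x : ℝ) (y : U → ℝ) :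
    (Sum.elim (fun _ => x) y) ⬝ᵥ (blkM a w D)⁻¹ *ᵥ Sum.elim (fun _ => x) y =
      y ⬝ᵥ D⁻¹ *ᵥ y + (x + w ⬝ᵥ D⁻¹ *ᵥ y) ^ 2 / (a - w ⬝ᵥ D⁻¹ *ᵥ w) := by
  let _ := hD.isUnit.invertible
  let _ := ((blk_posDef a w D hD).2 hs).isUnit.invertible
  set s := a - w ⬝ᵥ D⁻¹ *ᵥ w with hsd
  have ha : a = s + w ⬝ᵥ D⁻¹ *ᵥ w := by rw [hsd]; ring
  set t := (x + w ⬝ᵥ D⁻¹ *ᵥ y) / s with ht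
  have hts : t * s = x + w ⬝ᵥ D⁻¹ *ᵥ y := by rw [ht]; field_simp
  have key : (blkM a w D)⁻¹ *ᵥ Sum.elim (fun _ => x) y
      = Sum.elim (fun _ => t) (D⁻¹ *ᵥ (y + t • w)) := by
    have : Sum.elim (fun _ => x) y =
        blkM a w D *ᵥ Sum.elim (fun _ => t) (D⁻¹ *ᵥ (y + t • w)) := by
      rw [blk_mulVec, mulVec_mulVec, mul_inv_of_invertible, one_mulVec, mulVec_add, mulVec_smul,
        dotProduct_add, dotProduct_smul, smul_eq_mul]
      congr 1
      · ext; rw [ha]; linarith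
      · simp
    rw [this, mulVec_mulVec, inv_mul_of_invertible, one_mulVec]
  rw [key, blk_dot, mulVec_add, mulVec_smul, dotProduct_add, dotProduct_smul, smul_eq_mul,
    symm_inv_dot D hD y w, ht]
  field_simp
  ring

lemma blk_posDef_right (a : ℝ) (w : U → ℝ) (D : Matrix U U ℝ) (h : (blkM a w D).PosDef) :
    D.PosDef := by
  have := h.submatrix (e := Sum.inr) Sum.inr_injective
  exact this

lemma inv_nonneg_of (D : Matrix U U ℝ) (hD : D.PosDef) (hoff : ∀ i j, i ≠ j → D i j ≤ 0)
    (y : U → ℝ) (hy : ∀ i, 0 ≤ y i) (i : U) : 0 ≤ (D⁻¹ *ᵥ y) i := by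
  let _ := hD.isUnit.invertible
  set x := D⁻¹ *ᵥ y with hx
  have hDx : D *ᵥ x = y := by rw [hx, mulVec_mulVec, mul_inv_of_invertible, one_mulVec]
  set n : U → ℝ := fun i => max (-x i) 0 with hn
  set p : U → ℝ := fun i => max (x i) 0 with hp
  have hxp : x = p - n := by
    ext i; simp only [hn, hp, Pi.sub_apply]
    rcases le_total (x i) 0 with h | h
    · rw [max_eq_right h, max_eq_left (by linarith)]; ring
    · rw [max_eq_left h, max_eq_right (by linarith)]; ring
  have h1 : 0 ≤ n ⬝ᵥ D *ᵥ x := by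
    rw [hDx]; exact Finset.sum_nonneg fun i _ => mul_nonneg (le_max_right _ _) (hy i)
  have h2 : n ⬝ᵥ D *ᵥ p ≤ 0 := by
    refine Finset.sum_nonpos fun i _ => ?_
    simp only [mulVec, dotProduct, Finset.mul_sum]
    refine Finset.sum_nonpos fun j _ => ?_
    have hni : 0 ≤ n i := le_max_right _ _
    have hpj : 0 ≤ p j := le_max_right _ _
    by_cases hij : i = j
    · subst hij
      have : n i * p i = 0 := by
        simp only [hn, hp]
        rcases le_total (x i) 0 with h | h
        · rw [max_eq_right h]; ring
        · rw [max_eq_right (show -x i ≤ 0 by linarith)]; ring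
      have h5 : n i * (D i i * p i) = D i i * (n i * p i) := by ring
      rw [h5, this, mul_zero]
    · have := hoff i j hij
      have := mul_nonneg hni hpj
      nlinarith
  by_contra hneg
  have hn0 : n ≠ 0 := by
    intro h
    have := congrFun h i
    simp only [hn, Pi.zero_apply] at this
    have h3 := le_max_left (-x i) 0
    push Not at hneg
    linarith
  have h3 := hD.dotProduct_mulVec_pos hn0
  rw [star_trivial] at h3
  rw [hxp, mulVec_sub, dotProduct_sub] at h1
  linarith
end blk

lemma gauss_univ : ∫⁻ v : ℝ, ENNReal.ofReal (Real.exp (-(1/2) * v ^ 2)) =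
    ENNReal.ofReal (√(2 * Real.pi)) := by
  rw [← ofReal_integral_eq_lintegral_ofReal (integrable_exp_neg_mul_sq (by norm_num))
    (Filter.Eventually.of_forall fun _ => (Real.exp_pos _).le), integral_gaussian]
  congr 2; ring

lemma gauss_Ioi : ∫⁻ v in Set.Ioi (0:ℝ), ENNReal.ofReal (Real.exp (-(1/2) * v ^ 2)) =
    ENNReal.ofReal (√(2 * Real.pi) / 2) := by
  rw [← ofReal_integral_eq_lintegral_ofReal (integrable_exp_neg_mul_sq (by norm_num)).integrableOn
    (Filter.Eventually.of_forall fun _ => (Real.exp_pos _).le), integral_gaussian_Ioi]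
  congr 3; ring

lemma phi_cv (t c : ℝ) (ht : 0 < t) (hc : 0 ≤ c) :
    ∫⁻ v in (fun u : ℝ => t * u - c / u) '' Set.Ioi 0, ENNReal.ofReal (Real.exp (-(1/2) * v ^ 2)) =
    ∫⁻ u in Set.Ioi (0:ℝ), ENNReal.ofReal (t + c / u ^ 2) *
      ENNReal.ofReal (Real.exp (-(1/2) * (t * u - c / u) ^ 2)) := by
  rw [lintegral_image_eq_lintegral_abs_deriv_mul (f' := fun u => t + c / u ^ 2) measurableSet_Ioi]
  · refine setLIntegral_congr_fun measurableSet_Ioi fun u hu => ?_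
    have hu' : (0:ℝ) < u := hu

    rw [abs_of_nonneg (by positivity)]
  · intro u hu
    have hu' : (0:ℝ) < u := hu
    have h := ((hasDerivAt_id u).const_mul t).sub ((hasDerivAt_inv hu'.ne').const_mul c)
    refine HasDerivAt.hasDerivWithinAt ?_
    convert! h using 1
    field_simp
    try ring
  · refine StrictMonoOn.injOn ?_
    intro u hu v hv huv
    have hu' : (0:ℝ) < u := hu
    have : c / v ≤ c / u := by gcongr
    have : t * u < t * v := by gcongr
    simp only
    linarith

lemma phi_symm (t c : ℝ) (ht : 0 < t) (hc : 0 < c) :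
    ∫⁻ u in Set.Ioi (0:ℝ), ENNReal.ofReal t *
      ENNReal.ofReal (Real.exp (-(1/2) * (t * u - c / u) ^ 2)) =
    ∫⁻ u in Set.Ioi (0:ℝ), ENNReal.ofReal (c / u ^ 2) *
      ENNReal.ofReal (Real.exp (-(1/2) * (t * u - c / u) ^ 2)) := by
  have him : (fun u : ℝ => c / (t * u)) '' Set.Ioi 0 = Set.Ioi 0 := by
    ext x
    constructor
    · rintro ⟨u, hu, rfl⟩
      have hu' : (0:ℝ) < u := hu
      show 0 < c / (t * u)
      positivity
    · intro hx
      have hx' : (0:ℝ) < x := hx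
      refine ⟨c / (t * x), show 0 < c / (t * x) by positivity, ?_⟩
      simp only
      field_simp
  conv_lhs => rw [← him]
  rw [lintegral_image_eq_lintegral_abs_deriv_mul (f' := fun u => - (c / (t * u ^ 2)))
    measurableSet_Ioi]
  · refine setLIntegral_congr_fun measurableSet_Ioi fun u hu => ?_
    have hu' : (0:ℝ) < u := hu

    rw [abs_neg, abs_of_nonneg (by positivity), ← mul_assoc, ← ENNReal.ofReal_mul (by positivity)]
    have e1 : c / (t * u ^ 2) * t = c / u ^ 2 := by field_simp
    have e2 : t * (c / (t * u)) - c / (c / (t * u)) = -(t * u - c / u) := by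
      field_simp
      ring
    rw [e1, e2, neg_sq]
  · intro u hu
    have hu' : (0:ℝ) < u := hu
    have h := ((hasDerivAt_inv hu'.ne').const_mul (c / t))
    refine HasDerivAt.hasDerivWithinAt ?_
    convert! h using 1
    · ext y; show c / (t * y) = c / t * y⁻¹; field_simp
    · field_simp
  · intro u hu v hv huv
    have hu' : (0:ℝ) < u := hu
    have hv' : (0:ℝ) < v := hv
    simp only at huv
    field_simp at huv
    linarith

lemma phi_int (t c : ℝ) (ht : 0 < t) (hc : 0 ≤ c) :
    ∫⁻ u in Set.Ioi (0:ℝ), ENNReal.ofReal t *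
      ENNReal.ofReal (Real.exp (-(1/2) * (t * u - c / u) ^ 2)) =
    ENNReal.ofReal (√(2 * Real.pi) / 2) := by
  have h := phi_cv t c ht hc
  rcases hc.eq_or_lt with rfl | hc
  · simp only [zero_div, sub_zero, add_zero] at h ⊢
    rw [← h, ← gauss_Ioi]
    congr 2
    ext x
    constructor
    · rintro ⟨u, hu, rfl⟩
      exact mul_pos ht hu
    · intro hx
      refine ⟨x / t, div_pos hx ht, ?_⟩
      simp only
      field_simp
  · have him : (fun u : ℝ => t * u - c / u) '' Set.Ioi 0 = Set.univ := by
      refine Set.eq_univ_of_forall fun v => ?_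
      have h1 : |v| < √(v ^ 2 + 4 * t * c) := by
        rw [← Real.sqrt_sq_eq_abs]
        exact Real.sqrt_lt_sqrt (sq_nonneg _) (by nlinarith [mul_pos ht hc])
      have h2 : 0 < v + √(v ^ 2 + 4 * t * c) := by linarith [neg_abs_le v]
      have h3 : √(v ^ 2 + 4 * t * c) ^ 2 = v ^ 2 + 4 * t * c := Real.sq_sqrt (by positivity)
      generalize √(v ^ 2 + 4 * t * c) = r at h1 h2 h3
      refine ⟨(v + r) / (2 * t), div_pos h2 (by positivity), ?_⟩
      simp only
      field_simp
      nlinarith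
    rw [him, Measure.restrict_univ, gauss_univ] at h
    have h4 : ∫⁻ u in Set.Ioi (0:ℝ), ENNReal.ofReal (t + c / u ^ 2) *
        ENNReal.ofReal (Real.exp (-(1/2) * (t * u - c / u) ^ 2)) =
      (∫⁻ u in Set.Ioi (0:ℝ), ENNReal.ofReal t *
        ENNReal.ofReal (Real.exp (-(1/2) * (t * u - c / u) ^ 2))) +
      ∫⁻ u in Set.Ioi (0:ℝ), ENNReal.ofReal (c / u ^ 2) *
        ENNReal.ofReal (Real.exp (-(1/2) * (t * u - c / u) ^ 2)) := by
      rw [← lintegral_add_left (by fun_prop)]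
      refine setLIntegral_congr_fun measurableSet_Ioi fun u hu => ?_
      have hu' : (0:ℝ) < u := hu

      rw [ENNReal.ofReal_add ht.le (by positivity), add_mul]
    rw [h4, ← phi_symm t c ht hc, ← two_mul] at h
    rw [ENNReal.ofReal_div_of_pos (by norm_num), h]
    simp only [ENNReal.ofReal_ofNat]
    rw [mul_comm, ENNReal.mul_div_cancel_right (by norm_num) (by norm_num)]

/-- one-dimensional density (in the variable `s`). -/
noncomputable def gdens (t c s : ℝ) : ℝ :=
  Set.indicator (Set.Ioi 0) (fun s => √(2 / Real.pi) *
    Real.exp (-(1/2) * (t ^ 2 * s) - (1/2) * (c ^ 2 / s) + t * c) * t / √s) s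

lemma gdens_int (t c : ℝ) (ht : 0 < t) (hc : 0 ≤ c) :
    ∫⁻ s, ENNReal.ofReal (gdens t c s) = 2 := by
  have h0 : ∀ s, ENNReal.ofReal (gdens t c s) = Set.indicator (Set.Ioi 0) (fun s =>
      ENNReal.ofReal (√(2 / Real.pi) *
    Real.exp (-(1/2) * (t ^ 2 * s) - (1/2) * (c ^ 2 / s) + t * c) * t / √s)) s := by
    intro s
    unfold gdens
    by_cases h : s ∈ Set.Ioi (0:ℝ)
    · simp only [Set.indicator_of_mem h]
    · simp only [Set.indicator_of_notMem h, ENNReal.ofReal_zero]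
  simp_rw [h0]
  rw [lintegral_indicator measurableSet_Ioi]
  have him : (fun u : ℝ => u ^ 2) '' Set.Ioi 0 = Set.Ioi 0 := by
    ext x
    constructor
    · rintro ⟨u, hu, rfl⟩
      exact pow_pos (Set.mem_Ioi.1 hu) 2
    · intro hx
      exact ⟨√x, Real.sqrt_pos.2 hx, Real.sq_sqrt (le_of_lt hx)⟩
  conv_lhs => rw [← him]
  rw [lintegral_image_eq_lintegral_abs_deriv_mul (f' := fun u => 2 * u) measurableSet_Ioi]
  · have : ∀ u ∈ Set.Ioi (0:ℝ), ENNReal.ofReal |2 * u| * ENNReal.ofReal (√(2 / Real.pi) *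
        Real.exp (-(1/2) * (t ^ 2 * u ^ 2) - (1/2) * (c ^ 2 / u ^ 2) + t * c) * t / √(u ^ 2)) =
        ENNReal.ofReal (2 * √(2 / Real.pi)) * (ENNReal.ofReal t *
      ENNReal.ofReal (Real.exp (-(1/2) * (t * u - c / u) ^ 2))) := by
      intro u hu
      have hu' : (0:ℝ) < u := hu
      rw [abs_of_pos (by positivity), Real.sqrt_sq hu'.le, ← ENNReal.ofReal_mul (by positivity),
        ← ENNReal.ofReal_mul (by positivity), ← ENNReal.ofReal_mul (by positivity)]
      have : -(1/2) * (t ^ 2 * u ^ 2) - (1/2) * (c ^ 2 / u ^ 2) + t * c =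
        -(1/2) * (t * u - c / u) ^ 2 := by
        field_simp
        ring
      rw [this]
      congr 1
      field_simp
    rw [setLIntegral_congr_fun measurableSet_Ioi this, lintegral_const_mul _ (by fun_prop),
      phi_int t c ht hc, ← ENNReal.ofReal_mul (by positivity)]
    have : 2 * √(2 / Real.pi) * (√(2 * Real.pi) / 2) = 2 := by
      have : √(2 / Real.pi) * √(2 * Real.pi) = 2 := by
        rw [← Real.sqrt_mul (by positivity), Real.sqrt_eq_iff_mul_self_eq (by positivity) (by norm_num)]
        field_simp

      linarith
    rw [this]; norm_num
  · intro u _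
    simpa using ((hasDerivAt_pow 2 u).hasDerivWithinAt)
  · intro u hu v hv huv
    have hu' : (0:ℝ) < u := hu
    have hv' : (0:ℝ) < v := hv
    exact (pow_left_inj₀ hu'.le hv'.le two_ne_zero).1 huv

lemma gdens_int' (t c k : ℝ) (ht : 0 < t) (hc : 0 ≤ c) :
    ∫⁻ b, ENNReal.ofReal (gdens t c (2 * b - k)) = 1 := by
  have h := lintegral_image_eq_lintegral_abs_deriv_mul (s := Set.univ) (f := fun b : ℝ => 2 * b - k)
    (f' := fun _ => 2) MeasurableSet.univ (fun x _ => by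
      have := ((hasDerivAt_id x).const_mul 2).sub_const k
      simpa only [id, mul_one] using! this.hasDerivWithinAt) (fun x _ y _ h => by simpa using h)
      (fun s => ENNReal.ofReal (gdens t c s))
  have him : (fun b : ℝ => 2 * b - k) '' Set.univ = Set.univ :=
    Set.eq_univ_of_forall fun x => ⟨(x + k) / 2, trivial, by simp only; ring⟩
  have hm : Measurable (gdens t c) := by
    unfold gdens
    exact Measurable.indicator (by fun_prop) measurableSet_Ioi
  rw [him, Measure.restrict_univ, gdens_int t c ht hc, lintegral_const_mul _ (by fun_prop)] at h
  have h2 : ENNReal.ofReal |(2:ℝ)| = 2 := by norm_num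
  rw [h2] at h
  exact ((ENNReal.mul_right_inj (a := 2) (by norm_num) (by norm_num)).1 (by rw [← h, mul_one]))

section main
universe u
variable {U : Type*} [Fintype U] [DecidableEq U]

lemma Hmat_continuous (W : Matrix U U ℝ) : Continuous (Hmat W) := by
  unfold Hmat
  have h : Continuous fun β : U → ℝ => fun i => 2 * β i := by fun_prop
  exact h.matrix_diagonal.sub continuous_const

lemma Hmat_quad (W : Matrix U U ℝ) (β θ : U → ℝ) :
    θ ⬝ᵥ Hmat W β *ᵥ θ = 2 * ∑ i, β i * θ i ^ 2 - θ ⬝ᵥ W *ᵥ θ := by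
  unfold Hmat
  rw [sub_mulVec, dotProduct_sub]
  congr 1
  simp only [dotProduct, mulVec_diagonal, Finset.mul_sum]
  exact Finset.sum_congr rfl fun i _ => by ring

lemma Hmat_herm (W : Matrix U U ℝ) (hW : W.IsSymm) (β : U → ℝ) : (Hmat W β).IsHermitian := by
  unfold Hmat IsHermitian
  rw [conjTranspose_eq_transpose_of_trivial, transpose_sub, diagonal_transpose, hW.eq]

lemma measurableSet_posDef (W : Matrix U U ℝ) (hW : W.IsSymm) :
    MeasurableSet {β : U → ℝ | (Hmat W β).PosDef} := by
  have h : {β : U → ℝ | (Hmat W β).PosDef} =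
      (⋂ x : U → ℝ, {β | 0 ≤ x ⬝ᵥ Hmat W β *ᵥ x}) ∩ {β | (Hmat W β).det ≠ 0} := by
    ext β
    simp only [Set.mem_ofPred_eq, Set.mem_inter_iff, Set.mem_iInter]
    constructor
    · intro h
      exact ⟨fun x => by simpa using h.posSemidef.dotProduct_mulVec_nonneg x, h.det_pos.ne'⟩
    · rintro ⟨h1, h2⟩
      have : (Hmat W β).PosSemidef :=
        PosSemidef.of_dotProduct_mulVec_nonneg (Hmat_herm W hW β) (by simpa using h1)
      exact this.posDef_iff_det_ne_zero.2 h2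
  rw [h]
  refine MeasurableSet.inter (IsClosed.measurableSet (isClosed_iInter fun x => ?_)) ?_
  · exact isClosed_le continuous_const
      (Continuous.dotProduct continuous_const ((Hmat_continuous W).matrix_mulVec continuous_const))
  · exact ((isOpen_ne (x := (0:ℝ))).preimage (Hmat_continuous W).matrix_det).measurableSet

lemma nuDensity_measurable (W : Matrix U U ℝ) (hW : W.IsSymm) (θ η : U → ℝ) :
    Measurable (nuDensity W θ η) := by
  unfold nuDensity
  refine Measurable.indicator ?_ (measurableSet_posDef W hW)
  have h1 : Measurable fun β => (Hmat W β).det := (Hmat_continuous W).matrix_det.measurable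
  have h2 : Measurable fun β => θ ⬝ᵥ Hmat W β *ᵥ θ :=
    (Continuous.dotProduct continuous_const
      ((Hmat_continuous W).matrix_mulVec continuous_const)).measurable
  have h3 : Measurable fun β => η ⬝ᵥ (Hmat W β)⁻¹ *ᵥ η := by
    have : (fun β => η ⬝ᵥ (Hmat W β)⁻¹ *ᵥ η) =
        fun β => ((Hmat W β).det)⁻¹ * (η ⬝ᵥ (Hmat W β).adjugate *ᵥ η) := by
      ext β
      rw [inv_def, smul_mulVec, dotProduct_smul, smul_eq_mul, Ring.inverse_eq_inv']
    rw [this]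
    exact h1.inv.mul (Continuous.dotProduct continuous_const
      ((Hmat_continuous W).matrix_adjugate.matrix_mulVec continuous_const)).measurable
  fun_prop

lemma Hmat_blk (W : Matrix (PUnit.{u+1} ⊕ U) (PUnit.{u+1} ⊕ U) ℝ) (hW : W.IsSymm) (b : ℝ) (β : U → ℝ) :
    Hmat W (Sum.elim (fun _ => b) β) =
      blkM (2 * b - W (Sum.inl PUnit.unit) (Sum.inl PUnit.unit))
        (fun j => W (Sum.inl PUnit.unit) (Sum.inr j))
        (Hmat (W.submatrix Sum.inr Sum.inr) β) := by
  ext i j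
  rcases i with i | i <;> rcases j with j | j
  · simp [Hmat, blkM]
  · simp [Hmat, blkM]
  · simp [Hmat, blkM, hW.apply]
  · simp [Hmat, blkM, diagonal_apply]

lemma step_density (W : Matrix (PUnit.{u+1} ⊕ U) (PUnit.{u+1} ⊕ U) ℝ) (hW : W.IsSymm)
    (t h : ℝ) (θ η : U → ℝ) (b : ℝ) (β : U → ℝ) (w : U → ℝ) (WU : Matrix U U ℝ)
    (hw : w = fun j => W (Sum.inl PUnit.unit) (Sum.inr j))
    (hWU : WU = W.submatrix Sum.inr Sum.inr) :
    nuDensity W (Sum.elim (fun _ => t) θ) (Sum.elim (fun _ => h) η) (Sum.elim (fun _ => b) β) =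
      nuDensity WU θ (η + t • w) β *
      gdens t (h + w ⬝ᵥ (Hmat WU β)⁻¹ *ᵥ η)
        (2 * b - (W (Sum.inl PUnit.unit) (Sum.inl PUnit.unit) + w ⬝ᵥ (Hmat WU β)⁻¹ *ᵥ w)) := by
  unfold nuDensity
  have hH := Hmat_blk W hW b β
  rw [← hw, ← hWU] at hH
  set D := Hmat WU β with hD
  set a0 := W (Sum.inl PUnit.unit) (Sum.inl PUnit.unit)
  by_cases hDp : D.PosDef
  swap
  · rw [Set.indicator_of_notMem, Set.indicator_of_notMem, zero_mul]
    · exact hDp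
    · intro hc
      rw [Set.mem_ofPred_eq, hH] at hc
      exact hDp (blk_posDef_right _ _ _ hc)
  rw [Set.indicator_of_mem (show β ∈ {β | (Hmat WU β).PosDef} from hDp)]
  have hsub : 2 * b - (a0 + w ⬝ᵥ D⁻¹ *ᵥ w) = 2 * b - a0 - w ⬝ᵥ D⁻¹ *ᵥ w := by ring
  rw [hsub]
  have hiff := blk_posDef (2 * b - a0) w D hDp
  by_cases hs : 0 < 2 * b - a0 - w ⬝ᵥ D⁻¹ *ᵥ w
  swap
  · rw [Set.indicator_of_notMem, gdens, Set.indicator_of_notMem, mul_zero]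
    · exact hs
    · intro hc
      rw [Set.mem_ofPred_eq, hH] at hc
      exact hs (hiff.1 hc)
  rw [Set.indicator_of_mem (by rw [Set.mem_ofPred_eq, hH]; exact hiff.2 hs), gdens,
    Set.indicator_of_mem (Set.mem_Ioi.2 hs), hH, blk_det _ _ _ hDp, blk_quad,
    blk_inv_quad _ _ _ hDp hs, blk_dot]
  set s := 2 * b - a0 - w ⬝ᵥ D⁻¹ *ᵥ w with hsd
  have ha : 2 * b - a0 = s + w ⬝ᵥ D⁻¹ *ᵥ w := by rw [hsd]; ring
  rw [ha, ← hD, Real.sqrt_mul hDp.det_pos.le]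
  have hprod : ∏ i, (Sum.elim (fun _ => t) θ : PUnit.{u+1} ⊕ U → ℝ) i = t * ∏ i, θ i := by
    simp
  have hpi : (2 / Real.pi) ^ ((Fintype.card (PUnit.{u+1} ⊕ U) : ℝ) / 2) =
      √(2 / Real.pi) * (2 / Real.pi) ^ ((Fintype.card U : ℝ) / 2) := by
    rw [Real.sqrt_eq_rpow, ← Real.rpow_add (by positivity)]
    congr 1
    simp
    ring
  rw [hprod, hpi]
  have hexp : ∀ A B C : ℝ, A = B + C → Real.exp A = Real.exp B * Real.exp C := by
    intro A B C hABC; rw [hABC, Real.exp_add]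
  rw [hexp _ (-(1 / 2) * (θ ⬝ᵥ D *ᵥ θ) - (1 / 2) * ((η + t • w) ⬝ᵥ D⁻¹ *ᵥ (η + t • w))
      + (η + t • w) ⬝ᵥ θ)
    (-(1/2) * (t ^ 2 * s) - (1/2) * ((h + w ⬝ᵥ D⁻¹ *ᵥ η) ^ 2 / s) + t * (h + w ⬝ᵥ D⁻¹ *ᵥ η))]
  · have := hDp.det_pos
    field_simp
  · simp only [mulVec_add, mulVec_smul, dotProduct_add, add_dotProduct, dotProduct_smul,
      smul_dotProduct, smul_eq_mul]
    rw [symm_inv_dot D hDp η w]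
    ring

def MassOne (V : Type*) [Fintype V] [DecidableEq V] : Prop :=
  ∀ (W : Matrix V V ℝ), W.IsSymm → (∀ i j, 0 ≤ W i j) → ∀ θ η : V → ℝ, (∀ i, 0 < θ i) →
    (∀ i, 0 ≤ η i) → ∫⁻ β, ENNReal.ofReal (nuDensity W θ η β) = 1

lemma nuDensity_nonneg (W : Matrix U U ℝ) (θ η : U → ℝ) (hθ : ∀ i, 0 < θ i) (β : U → ℝ) :
    0 ≤ nuDensity W θ η β := by
  unfold nuDensity
  refine Set.indicator_nonneg (fun β _ => ?_) _
  have : 0 ≤ ∏ i, θ i := Finset.prod_nonneg fun i _ => (hθ i).le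
  positivity

lemma mass_step (hU : MassOne U) : MassOne (PUnit.{u+1} ⊕ U) := by
  intro W hW hpos θ η hθ hη
  set t := θ (Sum.inl PUnit.unit)
  set h := η (Sum.inl PUnit.unit)
  set θU : U → ℝ := fun i => θ (Sum.inr i)
  set ηU : U → ℝ := fun i => η (Sum.inr i)
  have hθe : θ = Sum.elim (fun _ => t) θU := by ext i; rcases i with i | i <;> rfl
  have hηe : η = Sum.elim (fun _ => h) ηU := by ext i; rcases i with i | i <;> rfl
  set w : U → ℝ := fun j => W (Sum.inl PUnit.unit) (Sum.inr j) with hw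
  set WU := W.submatrix Sum.inr Sum.inr with hWU
  have hmeas := nuDensity_measurable W hW θ η
  rw [← (volume_measurePreserving_sumPiEquivProdPi_symm (fun _ : PUnit.{u+1} ⊕ U => ℝ)).lintegral_comp_emb
    (MeasurableEquiv.measurableEmbedding _)]
  rw [Measure.volume_eq_prod, lintegral_prod_symm]
  swap
  · exact (hmeas.ennreal_ofReal.comp (MeasurableEquiv.measurable _)).aemeasurable
  have hsymmU : WU.IsSymm := by
    ext i j; exact hW.apply (Sum.inr i) (Sum.inr j)
  rw [← hU WU hsymmU (fun i j => hpos _ _) θU (ηU + t • w) (fun i => hθ _) (fun i =>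
    add_nonneg (hη _) (mul_nonneg (hθ _).le (hpos _ _)))]
  refine lintegral_congr fun β => ?_
  rw [← (volume_preserving_funUnique PUnit.{u+1} ℝ).symm.lintegral_comp_emb
    (MeasurableEquiv.measurableEmbedding _)]
  have key : ∀ b : ℝ, ENNReal.ofReal (nuDensity W θ η ((MeasurableEquiv.sumPiEquivProdPi
      (fun _ : PUnit.{u+1} ⊕ U => ℝ)).symm ((MeasurableEquiv.funUnique PUnit.{u+1} ℝ).symm b, β))) =
      ENNReal.ofReal (nuDensity WU θU (ηU + t • w) β) * ENNReal.ofReal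
      (gdens t (h + w ⬝ᵥ (Hmat WU β)⁻¹ *ᵥ ηU)
        (2 * b - (W (Sum.inl PUnit.unit) (Sum.inl PUnit.unit) + w ⬝ᵥ (Hmat WU β)⁻¹ *ᵥ w))) := by
    intro b
    have hb : ((MeasurableEquiv.sumPiEquivProdPi
      (fun _ : PUnit.{u+1} ⊕ U => ℝ)).symm ((MeasurableEquiv.funUnique PUnit.{u+1} ℝ).symm b, β)) =
      Sum.elim (fun _ => b) β := by
      ext i; rcases i with i | i <;> rfl
    rw [hb, hθe, hηe, step_density W hW t h θU ηU b β w WU hw hWU,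
      ENNReal.ofReal_mul (nuDensity_nonneg _ _ _ (fun i => hθ _) _)]
  simp_rw [key]
  by_cases hp : (Hmat WU β).PosDef
  · have hgm : ∀ c, Measurable (gdens t c) := by
      intro c
      unfold gdens
      exact Measurable.indicator (by fun_prop) measurableSet_Ioi
    have := hgm (h + w ⬝ᵥ (Hmat WU β)⁻¹ *ᵥ ηU)
    rw [lintegral_const_mul _ (by fun_prop), gdens_int' _ _ _ (hθ _), mul_one]
    refine add_nonneg (hη _) (Finset.sum_nonneg fun i _ => mul_nonneg (hpos _ _) ?_)
    refine inv_nonneg_of _ hp (fun i j hij => ?_) _ (fun i => hη _) i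
    simp [Hmat, diagonal_apply_ne _ hij, hWU, hpos]
  · have : nuDensity WU θU (ηU + t • w) β = 0 := by
      unfold nuDensity
      rw [Set.indicator_of_notMem]
      exact hp
    simp [this]

lemma nuDensity_equiv {V V' : Type*} [Fintype V] [DecidableEq V] [Fintype V'] [DecidableEq V']
    (e : V ≃ V') (W : Matrix V' V' ℝ) (θ η β : V' → ℝ) :
    nuDensity W θ η β = nuDensity (W.submatrix e e) (θ ∘ e) (η ∘ e) (β ∘ e) := by
  have hH : Hmat (W.submatrix e e) (β ∘ e) = (Hmat W β).submatrix e e := by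
    ext i j
    simp [Hmat, diagonal_apply]
  have hp : ((Hmat W β).submatrix e e).PosDef ↔ (Hmat W β).PosDef :=
    ⟨fun h => by simpa using h.submatrix e.symm.injective, fun h => h.submatrix e.injective⟩
  have hq : ∀ (M : Matrix V' V' ℝ) (x : V' → ℝ),
      (x ∘ e) ⬝ᵥ M.submatrix e e *ᵥ (x ∘ e) = x ⬝ᵥ M *ᵥ x := by
    intro M x
    rw [submatrix_mulVec_equiv, Function.comp_assoc, e.self_comp_symm, Function.comp_id,
      comp_equiv_dotProduct_comp_equiv]
  unfold nuDensity
  by_cases h : (Hmat W β).PosDef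
  · rw [Set.indicator_of_mem (show β ∈ {β | (Hmat W β).PosDef} from h), Set.indicator_of_mem
      (by rw [Set.mem_ofPred_eq, hH]; exact hp.2 h), hH, hq, inv_submatrix_equiv, hq,
      det_submatrix_equiv_self, comp_equiv_dotProduct_comp_equiv, Fintype.card_congr e,
      ← Equiv.prod_comp e]
    rfl
  · rw [Set.indicator_of_notMem (show β ∉ {β | (Hmat W β).PosDef} from h), Set.indicator_of_notMem
      (by rw [Set.mem_ofPred_eq, hH]; exact fun h' => h (hp.1 h'))]

lemma mass_equiv {V V' : Type*} [Fintype V] [DecidableEq V] [Fintype V'] [DecidableEq V']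
    (e : V ≃ V') (hV : MassOne V) : MassOne V' := by
  intro W hW hpos θ η hθ hη
  rw [← hV (W.submatrix e e) (hW.submatrix e) (fun i j => hpos _ _) (θ ∘ e) (η ∘ e)
    (fun i => hθ _) (fun i => hη _),
    ← (volume_measurePreserving_piCongrLeft (fun _ : V' => ℝ) e).lintegral_comp_emb
    (MeasurableEquiv.measurableEmbedding _)]
  refine lintegral_congr fun β => ?_
  rw [nuDensity_equiv e]
  congr 2
  ext i
  exact Equiv.piCongrLeft_apply_apply (fun _ : V' => ℝ) e β i

lemma mass_empty : MassOne PEmpty.{u+1} := by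
  intro W hW hpos θ η hθ hη
  have h : ∀ β, nuDensity W θ η β = 1 := by
    intro β
    unfold nuDensity
    rw [Set.indicator_of_mem]
    · simp
    · refine PosDef.of_dotProduct_mulVec_pos (Subsingleton.elim _ _) fun x hx => ?_
      exact absurd (Subsingleton.elim _ _) hx
  simp [h, volume_pi]

lemma mass_all (V : Type u) [Fintype V] : ∀ [DecidableEq V], MassOne V := by
  refine Fintype.induction_empty_option (P := fun V _ => ∀ [DecidableEq V], MassOne V)
    ?_ ?_ ?_ V
  · intro α β _ e h _
    classical
    let _ : Fintype α := Fintype.ofEquiv β e.symm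
    exact mass_equiv e h
  · intro inst
    have := mass_empty.{u}
    convert this
  · intro α _ h _
    classical
    exact mass_equiv ((Equiv.sumComm _ _).trans (Equiv.optionEquivSumPUnit.{u} α).symm) (mass_step.{u} h)

end main

/-- Laplace transform of `ν_V^{W,θ,η}`. -/
theorem nu_laplace_transform [Fintype V] [DecidableEq V] [Nonempty V]
    (W : Matrix V V ℝ) (hWsymm : W.IsSymm) (hWpos : ∀ i j, 0 ≤ W i j)
    (θ η : V → ℝ) (hθ : ∀ i, 0 < θ i) (hη : ∀ i, 0 ≤ η i)
    (l : V → ℝ) (hl : ∀ i, 0 ≤ l i) :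
    ∫ β, Real.exp (-∑ i, l i * β i) ∂(nu W θ η) =
      Real.exp (-(1 / 2) * ((fun i => Real.sqrt (θ i ^ 2 + l i)) ⬝ᵥ
            W *ᵥ (fun i => Real.sqrt (θ i ^ 2 + l i)))
          + (1 / 2) * (θ ⬝ᵥ W *ᵥ θ)
          + (η ⬝ᵥ (fun i => θ i - Real.sqrt (θ i ^ 2 + l i)))) *
        ∏ i, θ i / Real.sqrt (θ i ^ 2 + l i) := by
  set θ' : V → ℝ := fun i => Real.sqrt (θ i ^ 2 + l i) with hθ'
  have hpos' : ∀ i, 0 < θ' i := fun i => Real.sqrt_pos.2 (by have := hθ i; have := hl i; positivity)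
  have hsq : ∀ i, θ' i ^ 2 = θ i ^ 2 + l i := fun i =>
    Real.sq_sqrt (by have := hl i; positivity)
  have hdot : (η ⬝ᵥ (fun i => θ i - Real.sqrt (θ i ^ 2 + l i))) = η ⬝ᵥ θ - η ⬝ᵥ θ' := by
    rw [← dotProduct_sub]; rfl
  have hprod : ∏ i, θ i / Real.sqrt (θ i ^ 2 + l i) = (∏ i, θ i) / ∏ i, θ' i :=
    Finset.prod_div_distrib ..
  rw [hdot, hprod]
  set K := Real.exp (-(1 / 2) * (θ' ⬝ᵥ W *ᵥ θ') + (1 / 2) * (θ ⬝ᵥ W *ᵥ θ)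
          + (η ⬝ᵥ θ - η ⬝ᵥ θ')) * ((∏ i, θ i) / ∏ i, θ' i) with hK
  have hPp : 0 < ∏ i, θ' i := Finset.prod_pos fun i _ => hpos' i
  have hP : 0 < ∏ i, θ i := Finset.prod_pos fun i _ => hθ i
  have hK0 : 0 ≤ K := by positivity
  have key : ∀ β, nuDensity W θ η β * Real.exp (-∑ i, l i * β i) = K * nuDensity W θ' η β := by
    intro β
    unfold nuDensity
    by_cases h : (Hmat W β).PosDef
    swap
    · rw [Set.indicator_of_notMem (show β ∉ {β | (Hmat W β).PosDef} from h),
        Set.indicator_of_notMem (show β ∉ {β | (Hmat W β).PosDef} from h)]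
      simp
    rw [Set.indicator_of_mem (show β ∈ {β | (Hmat W β).PosDef} from h),
      Set.indicator_of_mem (show β ∈ {β | (Hmat W β).PosDef} from h), Hmat_quad, Hmat_quad, hK]
    have hsum : ∑ i, β i * θ' i ^ 2 = ∑ i, β i * θ i ^ 2 + ∑ i, l i * β i := by
      rw [← Finset.sum_add_distrib]
      exact Finset.sum_congr rfl fun i _ => by rw [hsq]; ring
    rw [hsum]
    set Q := η ⬝ᵥ (Hmat W β)⁻¹ *ᵥ η
    set S := ∑ i, β i * θ i ^ 2
    set L := ∑ i, l i * β i
    have hexp : Real.exp (-(1 / 2) * (2 * S - θ ⬝ᵥ W *ᵥ θ) - 1 / 2 * Q + η ⬝ᵥ θ) * Real.exp (-L) =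
      Real.exp (-(1 / 2) * (θ' ⬝ᵥ W *ᵥ θ') + (1 / 2) * (θ ⬝ᵥ W *ᵥ θ) + (η ⬝ᵥ θ - η ⬝ᵥ θ')) *
      Real.exp (-(1 / 2) * (2 * (S + L) - θ' ⬝ᵥ W *ᵥ θ') - 1 / 2 * Q + η ⬝ᵥ θ') := by
      rw [← Real.exp_add, ← Real.exp_add]
      congr 1
      ring
    have hPP : (∏ i, θ i) / (∏ i, θ' i) * ∏ i, θ' i = ∏ i, θ i := by field_simp
    generalize (2 / Real.pi) ^ ((Fintype.card V : ℝ) / 2) = c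
    generalize √(Hmat W β).det = d
    rw [← mul_div_assoc, div_mul_eq_mul_div]
    congr 1
    linear_combination c * (∏ i, θ i) * hexp - c * Real.exp (-(1 / 2) * (θ' ⬝ᵥ W *ᵥ θ') + (1 / 2) * (θ ⬝ᵥ W *ᵥ θ) + (η ⬝ᵥ θ - η ⬝ᵥ θ')) *
      Real.exp (-(1 / 2) * (2 * (S + L) - θ' ⬝ᵥ W *ᵥ θ') - 1 / 2 * Q + η ⬝ᵥ θ') * hPP
  have hcont : Measurable fun β : V → ℝ => Real.exp (-∑ i, l i * β i) := by fun_prop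
  rw [integral_eq_lintegral_of_nonneg_ae (Filter.Eventually.of_forall fun _ => (Real.exp_pos _).le)
    hcont.aestronglyMeasurable, nu, lintegral_withDensity_eq_lintegral_mul _
    (nuDensity_measurable W hWsymm θ η).ennreal_ofReal hcont.ennreal_ofReal]
  have : ∀ β : V → ℝ, ((fun β : V → ℝ => ENNReal.ofReal (nuDensity W θ η β)) *
      fun β : V → ℝ => ENNReal.ofReal (Real.exp (-∑ i, l i * β i))) β =
      ENNReal.ofReal K * ENNReal.ofReal (nuDensity W θ' η β) := by
    intro β
    rw [Pi.mul_apply, ← ENNReal.ofReal_mul (nuDensity_nonneg W θ η hθ β), key,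
      ENNReal.ofReal_mul hK0]
  rw [lintegral_congr this, lintegral_const_mul _ (nuDensity_measurable W hWsymm θ' η).ennreal_ofReal,
    mass_all V W hWsymm hWpos θ' η hpos' hη, mul_one, ENNReal.toReal_ofReal hK0]
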